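/- Let S be a nonempty perfect Polish space. Suppose that for each i ∈ ℕ we are given an arity k(i) ≥ 1 and a continuous nondegenerate function f_i : S^{k(i)} → S, and suppose ⟨H_ℓ : ℓ ∈ ℕ⟩ is a countable family of nowhere dense subsets of S. Then there exists an injective function a : (ℕ → Bool) → S (i.e., a family ⟨a_σ : σ ∈ 2^ℕ⟩ of continuum-many pairwise distinct elements of S) such that for every i ∈ ℕ, every ℓ ∈ ℕ, and every tuple (σ_1, …, σ_{k(i)}) of pairwise distinct elements of 2^ℕ, one has f_i(a_{σ_1}, …, a_{σ_{k(i)}}) ∉ H_ℓ. -/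

import Mathlib

open Function Set

/-- A function `f : S^k → S` is *nondegenerate* if there is a coordinate `i` such that,
for any fixed values of the other coordinates, the resulting one-variable function
`x ↦ f(a_1, …, a_{i-1}, x, a_{i+1}, …, a_k)` is a homeomorphism of `S` onto `S`. -/
def Nondegenerate {S : Type*} [TopologicalSpace S] {k : ℕ} (f : (Fin k → S) → S) : Prop :=
  ∃ i : Fin k, ∀ a : Fin k → S, IsHomeomorph (fun x : S => f (Function.update a i x))

open Filter Topology

/-- The restriction of an infinite binary sequence to its first `n` entries. -/
def cantorRestrict (n : ℕ) (x : ℕ → Bool) : Fin n → Bool := fun j => x j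

/-- The extension of a finite binary sequence by `false`. -/
def cantorExtend (n : ℕ) (s : Fin n → Bool) : ℕ → Bool :=
  fun j => if h : j < n then s ⟨j, h⟩ else false

theorem continuous_cantorRestrict (n : ℕ) : Continuous (cantorRestrict n) := by
  unfold cantorRestrict
  fun_prop

theorem cantorExtend_cantorRestrict_apply {n j : ℕ} (h : j < n) (x : ℕ → Bool) :
    cantorExtend n (cantorRestrict n x) j = x j := by
  simp [cantorExtend, cantorRestrict, h]

theorem tendstoUniformly_cantorExtend_cantorRestrict :
    TendstoUniformly (fun n x => cantorExtend n (cantorRestrict n x)) id atTop := by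
  rw [tendstoUniformly_iff_tendsto, Pi.uniformity, tendsto_iInf]
  intro j
  rw [tendsto_comap_iff]
  refine Tendsto.mono_right ?_ refl_le_uniformity
  rw [tendsto_principal]
  have h : ∀ᶠ n : ℕ in atTop, j < n := eventually_gt_atTop j
  filter_upwards [h.prod_inl (⊤ : Filter (ℕ → Bool))] with p hp
  simp [cantorExtend_cantorRestrict_apply hp]

/-- The continuous map on Cantor space whose value at `x` is determined by the first `n` entries
of `x`. -/
def cylinderMap {S : Type*} [TopologicalSpace S] (n : ℕ) (b : (Fin n → Bool) → S) :
    C(ℕ → Bool, S) :=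
  ⟨fun x => b (cantorRestrict n x),
    (continuous_of_discreteTopology (f := b)).comp (continuous_cantorRestrict n)⟩

theorem continuous_cylinderMap {S : Type*} [TopologicalSpace S] (n : ℕ) :
    Continuous (cylinderMap n : ((Fin n → Bool) → S) → C(ℕ → Bool, S)) := by
  refine ContinuousMap.continuous_of_continuous_uncurry _ ?_
  have h : Continuous fun p : (Fin n → Bool) × ((Fin n → Bool) → S) => p.2 p.1 :=
    continuous_prod_of_discrete_left.2 fun s => continuous_apply s
  exact h.comp (((continuous_cantorRestrict n).comp continuous_snd).prodMk continuous_fst)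

/-- Every continuous map on Cantor space is the limit of its cylinder approximations. -/
theorem tendsto_cylinderMap {S : Type*} [UniformSpace S] (a : C(ℕ → Bool, S)) :
    Tendsto (fun n => cylinderMap n fun s => a (cantorExtend n s)) atTop (𝓝 a) := by
  rw [ContinuousMap.tendsto_iff_tendstoUniformly]
  exact (CompactSpace.uniformContinuous_of_continuous a.continuous).comp_tendstoUniformly
    tendstoUniformly_cantorExtend_cantorRestrict

theorem isOpenMap_comp_injective {S α β : Type*} [TopologicalSpace S] {τ : α → β}
    (hτ : Injective τ) : IsOpenMap fun b : β → S => b ∘ τ := by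
  refine IsOpenMap.of_sections fun b => ⟨fun c => extend τ c b, ?_, ?_, ?_⟩
  · refine Continuous.continuousAt (continuous_pi fun y => ?_)
    by_cases hy : ∃ x, τ x = y
    · obtain ⟨x, rfl⟩ := hy
      simpa only [hτ.extend_apply] using continuous_apply x
    · simpa only [extend_apply' _ _ _ hy] using continuous_const
  · funext y
    by_cases hy : ∃ x, τ x = y
    · obtain ⟨x, rfl⟩ := hy
      simp [hτ.extend_apply]
    · simp [extend_apply' _ _ _ hy]
  · exact fun c => extend_comp hτ c b

/-- For a closed nowhere dense `F ⊆ S^ι`, densely many `b : β → S` (with `β` finite)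
have all their tuples with distinct indices outside `F`. -/
theorem dense_setOf_forall_injective_comp_notMem {S ι β : Type*} [TopologicalSpace S]
    [Finite ι] [Finite β] {F : Set (ι → S)} (hF : IsClosed F) (hd : Dense Fᶜ) :
    Dense {b : β → S | ∀ τ : ι → β, Injective τ → b ∘ τ ∉ F} := by
  have key : ∀ T : Set (ι → β), T.Finite → (∀ τ ∈ T, Injective τ) →
      Dense {b : β → S | ∀ τ ∈ T, b ∘ τ ∉ F} := by
    intro T hT
    induction T, hT using Set.Finite.induction_on with
    | empty => simp
    | @insert τ T _ _ ih =>
      intro h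
      have hτ : Dense {b : β → S | b ∘ τ ∈ Fᶜ} :=
        hd.preimage (isOpenMap_comp_injective (h τ (mem_insert _ _)))
      have ho : IsOpen {b : β → S | b ∘ τ ∈ Fᶜ} :=
        hF.isOpen_compl.preimage (by fun_prop)
      refine (hτ.inter_of_isOpen_left (ih fun σ hσ => h σ (mem_insert_of_mem _ hσ)) ho).mono ?_
      rintro b ⟨hb, hb'⟩ σ (rfl | hσ)
      exacts [hb, hb' σ hσ]
  exact key {τ | Injective τ} (Set.toFinite _) fun _ h => h

/-- **Mycielski's theorem**, for a single relation: a generic continuous map `a` on Cantor space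
sends tuples of distinct points outside a given closed nowhere dense set `F ⊆ S^ι`. -/
theorem eventually_residual_forall_injective_notMem {S ι : Type*} [UniformSpace S]
    [Finite ι] {F : Set (ι → S)} (hF : IsClosed F) (hd : Dense Fᶜ) :
    ∀ᶠ a in residual C(ℕ → Bool, S), ∀ σ : ι → ℕ → Bool, Injective σ → (fun m => a (σ m)) ∉ F := by
  let A (n : ℕ) : Set C(ℕ → Bool, S) :=
    {a | ∀ σ : ι → ℕ → Bool, Injective (fun m => cantorRestrict n (σ m)) →
      (fun m => a (σ m)) ∉ F}
  have hAo (n : ℕ) : IsOpen (A n) := by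
    have h1 : IsClosed {σ : ι → ℕ → Bool | Injective fun m => cantorRestrict n (σ m)} := by
      have hc : Continuous fun (σ : ι → ℕ → Bool) m => cantorRestrict n (σ m) :=
        continuous_pi fun m => (continuous_cantorRestrict n).comp (continuous_apply m)
      exact (isClosed_discrete {τ : ι → Fin n → Bool | Injective τ}).preimage hc
    have h2 : IsClosed {p : C(ℕ → Bool, S) × (ι → ℕ → Bool) | (fun m => p.1 (p.2 m)) ∈ F} :=
      hF.preimage (by fun_prop)
    rw [← isClosed_compl_iff]
    convert isClosedMap_fst_of_compactSpace _ ((h1.preimage continuous_snd).inter h2) using 1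
    ext a
    simp [A]
  have hAd (n : ℕ) : Dense (A n) := by
    rw [dense_iff_inter_open]
    rintro W hW ⟨a, ha⟩
    obtain ⟨m, hm, hnm⟩ := (((tendsto_cylinderMap a).eventually (hW.mem_nhds ha)).and
      (eventually_ge_atTop n)).exists
    obtain ⟨b, hbW, hb⟩ := (dense_setOf_forall_injective_comp_notMem hF hd).inter_open_nonempty _
      (hW.preimage (continuous_cylinderMap m)) ⟨_, hm⟩
    refine ⟨cylinderMap m b, hbW, fun σ hσ => hb (fun j => cantorRestrict m (σ j)) ?_⟩
    intro i j hij
    refine hσ (funext fun t => ?_)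
    exact congrFun hij ⟨t, t.2.trans_le hnm⟩
  have hA : ∀ᶠ a in residual C(ℕ → Bool, S), ∀ n, a ∈ A n :=
    eventually_countable_forall.2 fun n => residual_of_dense_open (hAo n) (hAd n)
  filter_upwards [hA] with a ha σ hσ
  have hsep : ∀ p : ι × ι, ∀ᶠ n in atTop, cantorRestrict n (σ p.1) = cantorRestrict n (σ p.2) →
      p.1 = p.2 := by
    rintro ⟨i, j⟩
    by_cases hij : i = j
    · simp [hij]
    obtain ⟨t, ht⟩ := Function.ne_iff.1 (hσ.ne hij)
    filter_upwards [eventually_gt_atTop t] with n hn h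
    exact absurd (congrFun h ⟨t, hn⟩) ht
  obtain ⟨n, hn⟩ := (eventually_all.2 hsep).exists
  exact ha n σ fun i j h => hn (i, j) h

theorem Nondegenerate.dense_preimage {S : Type*} [TopologicalSpace S] {k : ℕ}
    {f : (Fin k → S) → S} (hf : Nondegenerate f) {U : Set S} (hU : Dense U) :
    Dense (f ⁻¹' U) := by
  obtain ⟨i, hi⟩ := hf
  rw [dense_iff_inter_open]
  rintro W hW ⟨a, ha⟩
  have hc : Continuous fun x => update a i x := continuous_const.update i continuous_id
  obtain ⟨x, hxW, hx⟩ := (hU.preimage (hi a).isOpenMap).inter_open_nonempty _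
    (hW.preimage hc) ⟨a i, by simpa using ha⟩
  exact ⟨update a i x, hxW, hx⟩

theorem dense_setOf_apply_ne {S ι : Type*} [TopologicalSpace S] [PerfectSpace S] [T1Space S]
    {i j : ι} (hij : i ≠ j) : Dense {c : ι → S | c i ≠ c j} := by
  classical
  rw [dense_iff_inter_open]
  rintro W hW ⟨a, ha⟩
  have hc : Continuous fun x => update a i x := continuous_const.update i continuous_id
  obtain ⟨x, hxW, hx⟩ := (dense_compl_singleton (a j)).inter_open_nonempty _
    (hW.preimage hc) ⟨a i, by simpa using ha⟩
  exact ⟨update a i x, hxW, by simpa [update_of_ne hij.symm] using hx⟩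

/-- Let `S` be a nonempty perfect Polish space, `f i : S^{k i} → S` continuous nondegenerate
functions (with `k i ≥ 1`), and `H ℓ` nowhere dense subsets of `S`.  Then there is an injective
family `⟨a_σ : σ ∈ 2^ℕ⟩` of elements of `S` such that for all `i`, `ℓ`, and pairwise distinct
`σ_1, …, σ_{k i}`, we have `f i (a_{σ_1}, …, a_{σ_{k i}}) ∉ H ℓ`. -/
theorem stmt0 {S : Type*} [TopologicalSpace S] [PolishSpace S] [PerfectSpace S] [Nonempty S]
    (k : ℕ → ℕ) (hk : ∀ i, 1 ≤ k i)
    (f : ∀ i : ℕ, (Fin (k i) → S) → S)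
    (hfc : ∀ i, Continuous (f i)) (hfn : ∀ i, Nondegenerate (f i))
    (H : ℕ → Set S) (hH : ∀ l, IsNowhereDense (H l)) :
    ∃ a : (ℕ → Bool) → S, Function.Injective a ∧
      ∀ (i l : ℕ) (σ : Fin (k i) → (ℕ → Bool)), Function.Injective σ →
        f i (fun m => a (σ m)) ∉ H l := by
  let := TopologicalSpace.upgradeIsCompletelyMetrizable S
  have hinj := eventually_residual_forall_injective_notMem (S := S) (ι := Fin 2)
    (F := {c | c 0 = c 1}) (isClosed_eq (continuous_apply 0) (continuous_apply 1))
    (dense_setOf_apply_ne zero_ne_one)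
  have havoid : ∀ᶠ a in residual C(ℕ → Bool, S), ∀ (i l : ℕ) (σ : Fin (k i) → ℕ → Bool),
      Injective σ → (fun m => a (σ m)) ∉ f i ⁻¹' closure (H l) := by
    refine eventually_countable_forall.2 fun i => eventually_countable_forall.2 fun l => ?_
    refine eventually_residual_forall_injective_notMem (isClosed_closure.preimage (hfc i)) ?_
    exact (hfn i).dense_preimage (interior_eq_empty_iff_dense_compl.1 (hH l))
  have : Nonempty C(ℕ → Bool, S) := ⟨ContinuousMap.const _ (Classical.arbitrary S)⟩
  obtain ⟨a, ha, ha'⟩ := (dense_of_mem_residual (hinj.and havoid)).nonempty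
  refine ⟨a, fun x y hxy => ?_, fun i l σ hσ hmem => ha' i l σ hσ (subset_closure hmem)⟩
  by_contra hne
  refine ha ![x, y] (fun i j h => ?_) (by simpa using hxy)
  fin_cases i <;> fin_cases j <;> simp_all [Ne.symm hne]
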